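/- Let E be a real Hilbert space, γ > 0, and f : E → ℝ a differentiable function whose gradient is γ-Lipschitz: ‖gradient f x − gradient f y‖ ≤ γ * ‖x − y‖ for all x, y. Let η > 0 with C := 1 − γ*η > 0, let σ ∈ ℝ, and let θ, h, Δ ∈ E with θ' := θ − η • Δ, ⟪h, Δ⟫ ≥ ‖h‖², and ‖Δ‖² ≤ ‖h‖² + σ². Then ‖gradient f θ‖² ≤ (2/(η*C)) * (f θ − f θ') + (1/(γ*η*C) + 2) * ‖gradient f θ − h‖² + (2*γ*η/C) * σ². -/

import Mathlib

open scoped RealInnerProductSpace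

/-- The descent lemma: a differentiable function with `γ`-Lipschitz gradient is bounded above by
its first-order expansion plus a quadratic term. -/
theorem le_add_inner_gradient_add_sq
    {E : Type*} [NormedAddCommGroup E] [InnerProductSpace ℝ E] [CompleteSpace E]
    {γ : ℝ} {f : E → ℝ} (hdiff : Differentiable ℝ f)
    (hlip : ∀ x y, ‖gradient f x - gradient f y‖ ≤ γ * ‖x - y‖) (x v : E) :
    f (x + v) ≤ f x + ⟪gradient f x, v⟫ + γ / 2 * ‖v‖ ^ 2 := by
  have hderiv (t : ℝ) : HasDerivAt
      (fun t : ℝ => f (x + t • v) - t * ⟪gradient f x, v⟫ - t ^ 2 * (γ / 2 * ‖v‖ ^ 2))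
      (⟪gradient f (x + t • v), v⟫ - ⟪gradient f x, v⟫ - 2 * t * (γ / 2 * ‖v‖ ^ 2)) t := by
    have hline : HasDerivAt (fun t : ℝ => x + t • v) v t := by
      simpa using ((hasDerivAt_id t).smul_const v).const_add x
    have hf := (hdiff (x + t • v)).hasGradientAt.hasFDerivAt.comp_hasDerivAt t hline
    have hf' : HasDerivAt (fun t : ℝ => f (x + t • v)) ⟪gradient f (x + t • v), v⟫ t := by
      simpa [Function.comp_def] using hf
    have hsub := (hf'.sub ((hasDerivAt_id t).mul_const ⟪gradient f x, v⟫)).sub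
      ((hasDerivAt_pow 2 t).mul_const (γ / 2 * ‖v‖ ^ 2))
    refine hsub.congr_deriv ?_
    norm_num
  have hanti := antitoneOn_of_deriv_nonpos (convex_Icc (0 : ℝ) 1)
    (fun t _ => (hderiv t).continuousAt.continuousWithinAt)
    (fun t _ => (hderiv t).differentiableAt.differentiableWithinAt)
    (fun t ht => by
      rw [interior_Icc] at ht
      rw [(hderiv t).deriv, ← inner_sub_left]
      have hnorm : ‖gradient f (x + t • v) - gradient f x‖ ≤ γ * (t * ‖v‖) := by
        simpa [norm_smul, abs_of_pos ht.1] using hlip (x + t • v) x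
      have hinner := (real_inner_le_norm _ v).trans
        (mul_le_mul_of_nonneg_right hnorm (norm_nonneg v))
      linarith)
  have h01 := hanti (Set.left_mem_Icc.2 zero_le_one) (Set.right_mem_Icc.2 zero_le_one) zero_le_one
  simp only [one_smul, zero_smul, add_zero] at h01
  linarith

/-- Deterministic surrogate of the per-round gradient bound (equation (32))
in the proof of Theorem 1 of the paper. -/
theorem single_step_gradient_bound
    {E : Type*} [NormedAddCommGroup E] [InnerProductSpace ℝ E] [CompleteSpace E]
    (γ : ℝ) (hγ : 0 < γ) (f : E → ℝ) (hdiff : Differentiable ℝ f)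
    (hlip : ∀ x y, ‖gradient f x - gradient f y‖ ≤ γ * ‖x - y‖)
    (η : ℝ) (hη : 0 < η) (C : ℝ) (hC : C = 1 - γ * η) (hCpos : 0 < C)
    (σ : ℝ) (θ h Δ : E) (θ' : E) (hθ' : θ' = θ - η • Δ)
    (hunbiased : ⟪h, Δ⟫ ≥ ‖h‖ ^ 2) (hvar : ‖Δ‖ ^ 2 ≤ ‖h‖ ^ 2 + σ ^ 2) :
    ‖gradient f θ‖ ^ 2
      ≤ (2 / (η * C)) * (f θ - f θ')
        + (1 / (γ * η * C) + 2) * ‖gradient f θ - h‖ ^ 2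
        + (2 * γ * η / C) * σ ^ 2 := by
  have hdesc := le_add_inner_gradient_add_sq hdiff hlip θ (-(η • Δ))
  rw [← sub_eq_add_neg, ← hθ', inner_neg_right, real_inner_smul_right, norm_neg, norm_smul,
    Real.norm_of_nonneg hη.le] at hdesc
  have hsplit : ⟪gradient f θ, Δ⟫ = ⟪h, Δ⟫ + ⟪gradient f θ - h, Δ⟫ := by
    rw [inner_sub_left]; ring
  have hcs : -(‖gradient f θ - h‖ * ‖Δ‖) ≤ ⟪gradient f θ - h, Δ⟫ :=
    (abs_le.1 (abs_real_inner_le_norm _ _)).1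
  have htri : ‖gradient f θ‖ ^ 2 ≤ 2 * ‖gradient f θ - h‖ ^ 2 + 2 * ‖h‖ ^ 2 := by
    have hle : ‖gradient f θ‖ ≤ ‖gradient f θ - h‖ + ‖h‖ := by
      simpa using norm_add_le (gradient f θ - h) h
    nlinarith [norm_nonneg (gradient f θ), sq_nonneg (‖gradient f θ - h‖ - ‖h‖)]
  have hyoung : η * (‖gradient f θ - h‖ * ‖Δ‖)
      ≤ γ * η ^ 2 / 2 * ‖Δ‖ ^ 2 + 1 / (2 * γ) * ‖gradient f θ - h‖ ^ 2 := by
    have hsq : 0 ≤ (γ * η * ‖Δ‖ - ‖gradient f θ - h‖) ^ 2 / (2 * γ) := by positivity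
    have hexp : (γ * η * ‖Δ‖ - ‖gradient f θ - h‖) ^ 2 / (2 * γ)
        = γ * η ^ 2 / 2 * ‖Δ‖ ^ 2 + 1 / (2 * γ) * ‖gradient f θ - h‖ ^ 2
          - η * (‖gradient f θ - h‖ * ‖Δ‖) := by
      field_simp
      ring
    linarith
  have hinner : η * (‖h‖ ^ 2 - ‖gradient f θ - h‖ * ‖Δ‖) ≤ η * ⟪gradient f θ, Δ⟫ :=
    mul_le_mul_of_nonneg_left (by linarith) hη.le
  have hvar' : γ * η ^ 2 * ‖Δ‖ ^ 2 ≤ γ * η ^ 2 * (‖h‖ ^ 2 + σ ^ 2) :=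
    mul_le_mul_of_nonneg_left hvar (by positivity)
  have hh : η * C * ‖h‖ ^ 2
      ≤ f θ - f θ' + 1 / (2 * γ) * ‖gradient f θ - h‖ ^ 2 + γ * η ^ 2 * σ ^ 2 := by
    rw [hC]
    linarith
  have hdiv : ‖h‖ ^ 2
      ≤ (f θ - f θ' + 1 / (2 * γ) * ‖gradient f θ - h‖ ^ 2 + γ * η ^ 2 * σ ^ 2) / (η * C) := by
    rw [le_div_iff₀ (by positivity)]
    linarith
  calc ‖gradient f θ‖ ^ 2 ≤ 2 * ‖gradient f θ - h‖ ^ 2 + 2 * ‖h‖ ^ 2 := htri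
    _ ≤ 2 * ‖gradient f θ - h‖ ^ 2 + 2 * ((f θ - f θ'
        + 1 / (2 * γ) * ‖gradient f θ - h‖ ^ 2 + γ * η ^ 2 * σ ^ 2) / (η * C)) := by gcongr
    _ = _ := by
      clear hC
      field_simp
      ring
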